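/- Let α be a nonempty type, k, e ≥ 1, and let V₁,…,V_w be a 2ke-disperse family of subsets of α. For each m ≤ w let X^m_0, X^m_1, …, X^m_{2k-1} be subsets of ℕ whose union is all of ℕ. Then for every x ∈ ℕ there exist an index i < 2k and a set of indices I ⊆ {1,…,w} such that the subfamily {V_m : m ∈ I} is e-disperse and x ∈ ⋂_{m ∈ I} X^m_i. (This is the combinatorial content of the fact that the class [Q] produced by the Cross operation is a partition class: the sets ⋂_{m∈K} X^m_i, for K ranging over index sets with e-disperse subfamily and i < 2k, cover ℕ.) -/

import Mathlib

/-- A family `V : Fin w → Set α` is `K`-disperse if for every coloring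
`c : Fin w → Fin K` of the index set into `K` classes there is a class `l`
whose members have empty intersection (the empty intersection being `univ`). -/
def Disperse {α : Type*} {w : ℕ} (K : ℕ) (V : Fin w → Set α) : Prop :=
  ∀ c : Fin w → Fin K, ∃ l : Fin K, (⋂ m ∈ {m : Fin w | c m = l}, V m) = ∅

/-- The subfamily `{V m : m ∈ I}` is `e`-disperse: for every coloring of the
indices in `I` into `e` classes, some class has empty intersection. -/
def SubDisperse {α : Type*} {w : ℕ} (e : ℕ) (I : Set (Fin w)) (V : Fin w → Set α) : Prop :=
  ∀ d : Fin w → Fin e, ∃ l : Fin e, (⋂ m ∈ {m : Fin w | m ∈ I ∧ d m = l}, V m) = ∅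

/-- if `V₁,…,V_w` is `2ke`-disperse and, for each `m`, the sets
`X^m_0, …, X^m_{2k-1}` cover `ℕ`, then every `x ∈ ℕ` lies in some intersection
`⋂_{m ∈ I} X^m_i` where the subfamily `{V_m : m ∈ I}` is `e`-disperse. -/
theorem cross_is_partition_class {α : Type*} [Nonempty α] {w k e : ℕ}
    (hk : 1 ≤ k) (he : 1 ≤ e) (V : Fin w → Set α)
    (hV : Disperse (2 * k * e) V)
    (X : Fin w → Fin (2 * k) → Set ℕ)
    (hX : ∀ m : Fin w, (⋃ i : Fin (2 * k), X m i) = Set.univ) :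
    ∀ x : ℕ, ∃ i : Fin (2 * k), ∃ I : Set (Fin w),
      SubDisperse e I V ∧ x ∈ ⋂ m ∈ I, X m i := by
  intro x
  have hcover : ∀ m, ∃ i, x ∈ X m i := fun m =>
    Set.mem_iUnion.1 (hX m ▸ Set.mem_univ x)
  choose f hf using hcover
  by_contra! hcon
  have hnot : ∀ i, ¬ SubDisperse e {m | f m = i} V := fun i hi =>
    hcon i _ hi (Set.mem_iInter₂.2 fun m hm => hm ▸ hf m)
  simp only [SubDisperse, not_forall, not_exists] at hnot
  choose d hd using hnot
  obtain ⟨l, hl⟩ := hV fun m => finProdFinEquiv (f m, d (f m) m)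
  obtain ⟨⟨i, j⟩, rfl⟩ := finProdFinEquiv.surjective l
  refine hd i j ?_
  convert hl using 4 with m
  simp only [Set.mem_ofPred_eq, EmbeddingLike.apply_eq_iff_eq, Prod.mk.injEq]
  exact and_congr_right fun h => by rw [h]
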